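/- Let m ≤ n and let C be an invertible 2^n × 2^n complex matrix. Suppose there are functions ε : (ZMod 2)^m → ℂ with ε(t) ≠ 0 for all t, and a, b : (ZMod 2)^m → (ZMod 2)^n, such that C⁻¹ Z̃(t) C = ε(t) · X(a(t)) Z(b(t)) for every t ∈ (ZMod 2)^m. Then the label maps are additive: a(t + t') = a(t) + a(t') and b(t + t') = b(t) + b(t') for all t, t' ∈ (ZMod 2)^m. -/

import Mathlib

open Matrix BigOperators Complex

noncomputable section

/-- The 2×2 Pauli X matrix, indexed by `ZMod 2`. -/
def pX : Matrix (ZMod 2) (ZMod 2) ℂ := !![0, 1; 1, 0]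

/-- The 2×2 Pauli Z matrix, indexed by `ZMod 2`. -/
def pZ : Matrix (ZMod 2) (ZMod 2) ℂ := !![1, 0; 0, -1]

/-- `X(a) = X^{a_1} ⊗ ⋯ ⊗ X^{a_n}` as a `2^n × 2^n` matrix indexed by bit strings. -/
def XK {n : ℕ} (a : Fin n → ZMod 2) :
    Matrix (Fin n → ZMod 2) (Fin n → ZMod 2) ℂ :=
  Matrix.of fun y x => ∏ i, (pX ^ (a i).val) (y i) (x i)

/-- `Z(a) = Z^{a_1} ⊗ ⋯ ⊗ Z^{a_n}` as a `2^n × 2^n` matrix indexed by bit strings. -/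
def ZK {n : ℕ} (a : Fin n → ZMod 2) :
    Matrix (Fin n → ZMod 2) (Fin n → ZMod 2) ℂ :=
  Matrix.of fun y x => ∏ i, (pZ ^ (a i).val) (y i) (x i)

/-- Standard (computational) basis vector `e_x`. -/
def basisVec {ι : Type*} [DecidableEq ι] (x : ι) : ι → ℂ :=
  fun y => if y = x then 1 else 0

/-- Standard Hermitian inner product, conjugate-linear in the first argument. -/
def innerC {ι : Type*} [Fintype ι] (v w : ι → ℂ) : ℂ :=
  ∑ x, (starRingEnd ℂ) (v x) * w x

/-- Extension of a bit string in `(ZMod 2)^m` to `(ZMod 2)^n` by zeros (for `m ≤ n`). -/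
def extZ {n m : ℕ} (hm : m ≤ n) (t : Fin m → ZMod 2) : Fin n → ZMod 2 :=
  fun i => if h : (i : ℕ) < m then t ⟨i, h⟩ else 0

/-- The character `x ↦ (-1)^{b · x}` of `(ZMod 2)^n`. -/
def signChar {n : ℕ} (b x : Fin n → ZMod 2) : ℂ :=
  ∏ i, (-1 : ℂ) ^ ((b i).val * (x i).val)

lemma zmod_two_eq_zero_or_one (a : ZMod 2) : a = 0 ∨ a = 1 := by
  revert a
  decide

lemma pX_pow_apply (a y x : ZMod 2) :
    (pX ^ a.val) y x = if y = x + a then 1 else 0 := by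
  have h₀₀ : pX 0 0 = 0 := rfl
  have h₀₁ : pX 0 1 = 1 := rfl
  have h₁₀ : pX 1 0 = 1 := rfl
  have h₁₁ : pX 1 1 = 0 := rfl
  have one_add_one : (1 + 1 : ZMod 2) = 0 := rfl
  rcases zmod_two_eq_zero_or_one a with rfl | rfl <;>
  rcases zmod_two_eq_zero_or_one y with rfl | rfl <;>
  rcases zmod_two_eq_zero_or_one x with rfl | rfl <;>
  simp [ZMod.val_one, one_add_one, h₀₀, h₀₁, h₁₀, h₁₁]

lemma pZ_pow_apply (b y x : ZMod 2) :
    (pZ ^ b.val) y x = if y = x then (-1 : ℂ) ^ (b.val * x.val) else 0 := by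
  have h₀₀ : pZ 0 0 = 1 := rfl
  have h₀₁ : pZ 0 1 = 0 := rfl
  have h₁₀ : pZ 1 0 = 0 := rfl
  have h₁₁ : pZ 1 1 = -1 := rfl
  rcases zmod_two_eq_zero_or_one b with rfl | rfl <;>
  rcases zmod_two_eq_zero_or_one y with rfl | rfl <;>
  rcases zmod_two_eq_zero_or_one x with rfl | rfl <;>
  simp [ZMod.val_one, h₀₀, h₀₁, h₁₀, h₁₁]

lemma neg_one_pow_val_add_mul (b c x : ZMod 2) :
    (-1 : ℂ) ^ ((b + c).val * x.val) =
      (-1 : ℂ) ^ (b.val * x.val) * (-1 : ℂ) ^ (c.val * x.val) := by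
  rw [← pow_add]
  apply neg_one_pow_congr
  revert b c x
  decide

lemma signChar_add_left {n : ℕ} (b c x : Fin n → ZMod 2) :
    signChar (b + c) x = signChar b x * signChar c x := by
  simp only [signChar, ← Finset.prod_mul_distrib, Pi.add_apply, neg_one_pow_val_add_mul]

lemma signChar_comm {n : ℕ} (b x : Fin n → ZMod 2) : signChar b x = signChar x b := by
  simp only [signChar, mul_comm]

lemma signChar_add_right {n : ℕ} (b x y : Fin n → ZMod 2) :
    signChar b (x + y) = signChar b x * signChar b y := by
  simp only [signChar_comm b, signChar_add_left]

lemma signChar_ne_zero {n : ℕ} (b x : Fin n → ZMod 2) : signChar b x ≠ 0 :=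
  Finset.prod_ne_zero_iff.2 fun _ _ => pow_ne_zero _ (by norm_num)

lemma signChar_zero_right {n : ℕ} (b : Fin n → ZMod 2) : signChar b 0 = 1 := by
  simp [signChar]

lemma signChar_single {n : ℕ} (b : Fin n → ZMod 2) (i : Fin n) :
    signChar b (Pi.single i 1) = (-1 : ℂ) ^ (b i).val := by
  rw [signChar, Finset.prod_eq_single i]
  · simp [ZMod.val_one]
  · intro j _ hj
    simp [hj]
  · simp

lemma signChar_injective {n : ℕ} :
    Function.Injective (signChar : (Fin n → ZMod 2) → (Fin n → ZMod 2) → ℂ) := by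
  intro b c h
  funext i
  have hi := congrFun h (Pi.single i 1)
  rw [signChar_single, signChar_single] at hi
  generalize b i = u at hi ⊢
  generalize c i = v at hi ⊢
  fin_cases u <;> fin_cases v <;> first | rfl | (exfalso; norm_num [ZMod.val] at hi)

lemma XK_apply {n : ℕ} (a y x : Fin n → ZMod 2) :
    XK a y x = if y = x + a then 1 else 0 := by
  simp only [XK, Matrix.of_apply, pX_pow_apply, Finset.prod_ite_zero, Finset.mem_univ,
    true_imp_iff, Finset.prod_const_one, funext_iff, Pi.add_apply]

lemma ZK_eq_diagonal {n : ℕ} (b : Fin n → ZMod 2) : ZK b = Matrix.diagonal (signChar b) := by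
  ext y x
  simp only [ZK, Matrix.of_apply, pZ_pow_apply, Finset.prod_ite_zero, Finset.mem_univ,
    true_imp_iff, funext_iff, Matrix.diagonal_apply, signChar]
  split_ifs with h
  · rw [funext h]
  · rfl

lemma ZK_add {n : ℕ} (b c : Fin n → ZMod 2) : ZK (b + c) = ZK b * ZK c := by
  simp only [ZK_eq_diagonal, Matrix.diagonal_mul_diagonal]
  congr 1
  funext x
  exact signChar_add_left b c x

lemma XK_mul_ZK_apply {n : ℕ} (a b y x : Fin n → ZMod 2) :
    (XK a * ZK b) y x = if y = x + a then signChar b x else 0 := by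
  rw [ZK_eq_diagonal, Matrix.mul_diagonal, XK_apply, ite_mul, one_mul, zero_mul]

lemma XK_mul_ZK_mul_XK_mul_ZK {n : ℕ} (a b c d : Fin n → ZMod 2) :
    (XK a * ZK b) * (XK c * ZK d) = signChar b c • (XK (a + c) * ZK (b + d)) := by
  ext y x
  rw [Matrix.mul_apply, Finset.sum_eq_single (x + c)]
  · simp only [XK_mul_ZK_apply, Matrix.smul_apply, smul_eq_mul, signChar_add_left,
      signChar_add_right, if_true, add_assoc, add_comm c a]
    split_ifs <;> ring
  · intro z _ hz
    rw [XK_mul_ZK_apply c, if_neg hz, mul_zero]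
  · simp

/-- Pauli operators that agree up to a nonzero scalar have the same labels. -/
lemma labels_eq_of_smul_XK_mul_ZK_eq {n : ℕ} {k l : ℂ} (hk : k ≠ 0)
    {a b c d : Fin n → ZMod 2} (h : k • (XK a * ZK b) = l • (XK c * ZK d)) :
    a = c ∧ b = d := by
  have entry (y x) := congrFun (congrFun h y) x
  simp only [Matrix.smul_apply, smul_eq_mul, XK_mul_ZK_apply] at entry
  have h0 := entry a 0
  simp only [zero_add, if_true, signChar_zero_right, mul_one] at h0
  have hac : a = c := by
    by_contra hne
    exact hk (by simpa [hne] using h0)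
  subst hac
  simp only [if_true, mul_one] at h0
  subst h0
  refine ⟨rfl, signChar_injective ?_⟩
  funext x
  simpa [hk] using entry (x + a) x

lemma extZ_add {n m : ℕ} (hm : m ≤ n) (t t' : Fin m → ZMod 2) :
    extZ hm (t + t') = extZ hm t + extZ hm t' := by
  funext i
  simp only [extZ, Pi.add_apply]
  split_ifs <;> simp

theorem stmt13 (n m : ℕ) (hm : m ≤ n)
    (C : Matrix (Fin n → ZMod 2) (Fin n → ZMod 2) ℂ) (hC : IsUnit C)
    (ε : (Fin m → ZMod 2) → ℂ) (hε : ∀ t, ε t ≠ 0)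
    (a b : (Fin m → ZMod 2) → (Fin n → ZMod 2))
    (hconj : ∀ t, C⁻¹ * ZK (extZ hm t) * C = ε t • (XK (a t) * ZK (b t))) :
    ∀ t t', a (t + t') = a t + a t' ∧ b (t + t') = b t + b t' := by
  intro t t'
  have hdet : IsUnit C.det := (Matrix.isUnit_iff_isUnit_det C).1 hC
  have hmul : C⁻¹ * ZK (extZ hm (t + t')) * C =
      (C⁻¹ * ZK (extZ hm t) * C) * (C⁻¹ * ZK (extZ hm t') * C) := by
    rw [extZ_add, ZK_add]
    simp only [Matrix.mul_assoc, Matrix.mul_nonsing_inv_cancel_left _ _ hdet]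
  rw [hconj, hconj, hconj, Matrix.smul_mul, Matrix.mul_smul, XK_mul_ZK_mul_XK_mul_ZK,
    smul_smul, smul_smul] at hmul
  exact labels_eq_of_smul_XK_mul_ZK_eq (hε _) hmul
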